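/- The series ∑_{r=1}^{∞} ( H_r ( ζ(r+1) − 1 ) − L(r+1) ) converges to 0, where L(s) = ∑_{n=2}^{∞} (log n) n^{−s}; equivalently, ∑_{r=1}^{∞} ( H_r ( ζ(r+1) − 1 ) + ζ′(r+1) ) = 0, where ζ′ is the derivative of the Riemann zeta function. -/

import Mathlib

open Filter Finset

/-- The Riemann zeta function at integer arguments `s > 1`, as a real series `∑_{n≥1} n^{-s}`. -/
noncomputable def zetaR (s : ℕ) : ℝ := ∑' n : ℕ, 1 / ((n : ℝ) + 1) ^ s

/-- The harmonic number `H_m = ∑_{j=1}^{m} 1/j`. -/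
noncomputable def H (m : ℕ) : ℝ := ∑ j ∈ Finset.range m, 1 / ((j : ℝ) + 1)

/-- `L(s) = ∑_{n=2}^{∞} (log n) n^{-s} = -ζ′(s)` for integer `s > 1`. -/
noncomputable def Lfun (s : ℕ) : ℝ := ∑' n : ℕ, Real.log ((n : ℝ) + 2) / ((n : ℝ) + 2) ^ s

/-- Tonelli for nonnegative double series, in `HasSum` form. -/
theorem hasSum_tsum_swap_of_nonneg {F : ℕ → ℕ → ℝ} {g : ℕ → ℝ} {S : ℝ}
    (hF : ∀ n r, 0 ≤ F n r) (hg : ∀ n, HasSum (F n) (g n)) (hS : HasSum g S) :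
    HasSum (fun r => ∑' n, F n r) S := by
  have hsum : Summable (fun p : ℕ × ℕ => F p.1 p.2) := by
    rw [summable_prod_of_nonneg (fun p => hF p.1 p.2)]
    refine ⟨fun n => (hg n).summable, ?_⟩
    simpa only [(hg _).tsum_eq] using hS.summable
  have htotal : HasSum (fun p : ℕ × ℕ => F p.1 p.2) S := by
    have h := hsum.hasSum.prod_fiberwise hg
    rw [hS.unique h]
    exact hsum.hasSum
  have hswap : HasSum (fun p : ℕ × ℕ => F p.2 p.1) S :=
    (Equiv.prodComm ℕ ℕ).hasSum_iff.mpr htotal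
  exact hswap.prod_fiberwise fun r => (hswap.summable.prod_factor r).hasSum

theorem H_nonneg (m : ℕ) : 0 ≤ H m :=
  Finset.sum_nonneg fun _ _ => by positivity

/-- The generating function of the harmonic numbers. -/
theorem hasSum_H_mul_pow {x : ℝ} (h0 : 0 ≤ x) (h1 : x < 1) :
    HasSum (fun r : ℕ => H (r + 1) * x ^ (r + 1)) (-Real.log (1 - x) * (1 - x)⁻¹) := by
  have hx : |x| < 1 := by rwa [abs_of_nonneg h0]
  have hlog := Real.hasSum_pow_div_log_of_abs_lt_one hx
  have hgeom := hasSum_geometric_of_lt_one h0 h1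
  have h := hasSum_sum_range_mul_of_summable_norm hlog.summable.norm hgeom.summable.norm
  rw [hlog.tsum_eq, hgeom.tsum_eq] at h
  refine h.congr_fun ?_
  intro r
  rw [H, Finset.sum_mul]
  refine Finset.sum_congr rfl fun k hk => ?_
  have hk' : r + 1 = (k + 1) + (r - k) := by
    have := Finset.mem_range.mp hk
    omega
  rw [hk', pow_add]
  ring

theorem hasSum_H_div_pow (n : ℕ) :
    HasSum (fun r : ℕ => H (r + 1) / ((n : ℝ) + 2) ^ (r + 2))
      ((Real.log (n + 2) - Real.log (n + 1)) / (n + 1)) := by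
  have hn : (0 : ℝ) < n + 1 := by positivity
  have hn2 : (0 : ℝ) < n + 2 := by positivity
  have hsub : 1 - ((n : ℝ) + 2)⁻¹ = (n + 1) / (n + 2) := by
    field_simp
    ring
  have h := (hasSum_H_mul_pow (x := ((n : ℝ) + 2)⁻¹) (by positivity)
    (inv_lt_one_of_one_lt₀ (by linarith))).mul_left ((n : ℝ) + 2)⁻¹
  rw [hsub, Real.log_div hn.ne' hn2.ne'] at h
  have hval : ((n : ℝ) + 2)⁻¹ * (-(Real.log (n + 1) - Real.log (n + 2)) * (((n : ℝ) + 1) / (n + 2))⁻¹) =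
      (Real.log (n + 2) - Real.log (n + 1)) / (n + 1) := by
    field_simp
    ring
  rw [hval] at h
  refine h.congr_fun fun r => ?_
  rw [inv_pow, pow_succ _ (r + 1)]
  field_simp

theorem hasSum_log_div_pow (n : ℕ) :
    HasSum (fun r : ℕ => Real.log ((n : ℝ) + 2) / ((n : ℝ) + 2) ^ (r + 2))
      (Real.log (n + 2) / ((n + 2) * (n + 1))) := by
  have hn : (0 : ℝ) < n + 1 := by positivity
  have hn2 : (0 : ℝ) < n + 2 := by positivity
  have hsub : 1 - ((n : ℝ) + 2)⁻¹ = (n + 1) / (n + 2) := by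
    field_simp
    ring
  have h := (hasSum_geometric_of_lt_one (r := ((n : ℝ) + 2)⁻¹) (by positivity)
    (inv_lt_one_of_one_lt₀ (by linarith))).mul_left (Real.log ((n : ℝ) + 2) / ((n : ℝ) + 2) ^ 2)
  rw [hsub] at h
  have hval : Real.log ((n : ℝ) + 2) / (n + 2) ^ 2 * (((n : ℝ) + 1) / (n + 2))⁻¹ =
      Real.log (n + 2) / ((n + 2) * (n + 1)) := by
    field_simp
  rw [hval] at h
  refine h.congr_fun fun r => ?_
  rw [inv_pow, pow_add]
  field_simp

theorem summable_one_div_add_one_sq : Summable (fun n : ℕ => 1 / ((n : ℝ) + 1) ^ 2) := by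
  have h := (summable_nat_add_iff 1).mpr
    (Real.summable_one_div_nat_pow.mpr (one_lt_two : 1 < 2))
  simpa using h

theorem summable_log_sub_log_div :
    Summable (fun n : ℕ => (Real.log ((n : ℝ) + 2) - Real.log (n + 1)) / (n + 1)) := by
  refine Summable.of_nonneg_of_le (fun n => ?_) (fun n => ?_) summable_one_div_add_one_sq
  · have : Real.log ((n : ℝ) + 1) ≤ Real.log (n + 2) :=
      Real.log_le_log (by positivity) (by linarith)
    exact div_nonneg (by linarith) (by positivity)
  · have hn : (0 : ℝ) < n + 1 := by positivity
    have h := Real.log_le_sub_one_of_pos (x := ((n : ℝ) + 2) / (n + 1)) (by positivity)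
    rw [Real.log_div (by positivity) hn.ne'] at h
    have h2 : ((n : ℝ) + 2) / (n + 1) - 1 = 1 / (n + 1) := by
      field_simp
      ring
    rw [h2] at h
    calc (Real.log ((n : ℝ) + 2) - Real.log (n + 1)) / (n + 1)
        ≤ 1 / (n + 1) / (n + 1) := by gcongr
      _ = 1 / ((n : ℝ) + 1) ^ 2 := by rw [div_div, sq]

theorem tendsto_log_div_add_one :
    Tendsto (fun N : ℕ => Real.log ((N : ℝ) + 1) / (N + 1)) atTop (nhds 0) := by
  have h : Tendsto (fun x : ℝ => Real.log x / x) atTop (nhds 0) :=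
    Real.isLittleO_log_id_atTop.tendsto_div_nhds_zero
  exact h.comp (tendsto_atTop_add_const_right _ 1 tendsto_natCast_atTop_atTop)

theorem sum_log_div_eq (N : ℕ) :
    ∑ n ∈ Finset.range N, Real.log ((n : ℝ) + 2) / ((n + 2) * (n + 1)) =
      ∑ n ∈ Finset.range N, (Real.log ((n : ℝ) + 2) - Real.log (n + 1)) / (n + 1) -
        Real.log ((N : ℝ) + 1) / (N + 1) := by
  induction N with
  | zero => simp
  | succ N ih =>
    rw [Finset.sum_range_succ, Finset.sum_range_succ, ih]
    have h : ((N + 1 : ℕ) : ℝ) + 1 = N + 2 := by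
      push_cast
      ring
    rw [h]
    have hn : (N : ℝ) + 1 ≠ 0 := by positivity
    have hn2 : (N : ℝ) + 2 ≠ 0 := by positivity
    field_simp
    ring

theorem log_add_two_nonneg (n : ℕ) : 0 ≤ Real.log ((n : ℝ) + 2) :=
  Real.log_nonneg (by linarith [(Nat.cast_nonneg n : (0 : ℝ) ≤ n)])

theorem hasSum_log_div {S : ℝ}
    (hS : HasSum (fun n : ℕ => (Real.log ((n : ℝ) + 2) - Real.log (n + 1)) / (n + 1)) S) :
    HasSum (fun n : ℕ => Real.log ((n : ℝ) + 2) / ((n + 2) * (n + 1))) S := by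
  rw [hasSum_iff_tendsto_nat_of_nonneg
    (fun n => div_nonneg (log_add_two_nonneg n) (by positivity))]
  simp only [sum_log_div_eq]
  simpa using hS.tendsto_sum_nat.sub tendsto_log_div_add_one

theorem zetaR_sub_one (r : ℕ) : zetaR (r + 2) - 1 = ∑' n : ℕ, 1 / ((n : ℝ) + 2) ^ (r + 2) := by
  have hs : Summable (fun n : ℕ => 1 / ((n : ℝ) + 1) ^ (r + 2)) := by
    have h := (summable_nat_add_iff 1).mpr
      (Real.summable_one_div_nat_pow.mpr (by omega : 1 < r + 2))
    simpa using h
  rw [zetaR, hs.tsum_eq_zero_add]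
  have h (n : ℕ) : ((n + 1 : ℕ) : ℝ) + 1 = n + 2 := by
    push_cast
    ring
  simp only [h]
  simp

/-- The series `∑_{r=1}^{∞} (H_r (ζ(r+1) − 1) − L(r+1))` converges to `0`, i.e.
`∑_{r=1}^{∞} (H_r (ζ(r+1) − 1) + ζ′(r+1)) = 0`. -/
theorem stmt_11 :
    Tendsto (fun N : ℕ => ∑ r ∈ Finset.range N,
        (H (r + 1) * (zetaR (r + 2) - 1) - Lfun (r + 2)))
      atTop (nhds 0) := by
  have hS := summable_log_sub_log_div.hasSum
  have h1 := hasSum_tsum_swap_of_nonneg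
    (fun n r => div_nonneg (H_nonneg (r + 1)) (by positivity)) hasSum_H_div_pow hS
  have h2 := hasSum_tsum_swap_of_nonneg
    (fun n r => div_nonneg (log_add_two_nonneg n) (by positivity)) hasSum_log_div_pow
    (hasSum_log_div hS)
  have h := (h1.sub h2).tendsto_sum_nat
  rw [sub_self] at h
  convert h using 5 with N r
  · rw [zetaR_sub_one, ← tsum_mul_left]
    simp only [mul_one_div]
  · rfl
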